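/- arXiv:1912.11005 — 8 statements merged into one kernel-verified Lean document; each statement's English description precedes it below -/
import Mathlib

section
/- Let d ≥ 1 be an integer, p > 1, e ∈ (0,1), and set r = 2/(1−e), μ = (1−e)/2, ℓ = 4/(p−1). Let ρ_P, Ψ_P : (0,∞) → ℝ be smooth with ρ_P > 0 and suppose they satisfy on (0,∞) the blow-up profile equations (∂_ZΨ_P)² + ρ_P^{p−1} + μ(r−2)Ψ_P + μZ∂_ZΨ_P = 1 and ΔΨ_P + μℓ(r−1)/2 + (2∂_ZΨ_P + μZ)(∂_Zρ_P/ρ_P) = 0. Define w, σ : ℝ → ℝ by the Emden transform ∂_ZΨ_P(e^x) = −(μ/2)e^x w(x) and ρ_P(e^x)^{(p−1)/2} = (μ√ℓ/2) e^x σ(x). Then (w,σ) satisfies on ℝ the autonomous system of spherically symmetric self-similar compressible Euler flows: (w−1)w' + ℓσσ' + (w² − rw + ℓσ²) = 0 and (σ/ℓ)w' + (w−1)σ' + σ[(d/ℓ + 1)w − r] = 0. -/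
noncomputable section

/-- Radial Laplacian in dimension `d`: `Δf = f'' + (d-1)/Z · f'`. -/
def radialLaplacian (d : ℕ) (f : ℝ → ℝ) (Z : ℝ) : ℝ :=
  deriv (deriv f) Z + ((d : ℝ) - 1) / Z * deriv f Z

/-- If `f (exp x) = c * exp x * g x` with `c ≠ 0`, then `g' = f' (exp x) / c - g`. -/
theorem hasDerivAt_emden {f g : ℝ → ℝ} {c f' x : ℝ} (hc : c ≠ 0)
    (hfg : ∀ y, f (Real.exp y) = c * Real.exp y * g y) (hf : HasDerivAt f f' (Real.exp x)) :
    HasDerivAt g (f' / c - g x) x := by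
  have hg : g = fun y => f (Real.exp y) / (c * Real.exp y) := by
    funext y
    rw [hfg y]
    field_simp
  have hcx : c * Real.exp x ≠ 0 := mul_ne_zero hc (Real.exp_ne_zero x)
  have h := (hf.comp x (Real.hasDerivAt_exp x)).div ((Real.hasDerivAt_exp x).const_mul c) hcx
  rw [show f ∘ Real.exp / (fun y => c * Real.exp y) = g from hg.symm] at h
  refine h.congr_deriv ?_
  rw [Function.comp_apply, hfg x]
  field_simp

/-- the Emden transform maps the blow-up profile equations for the
defocusing NLS to the autonomous system of spherically symmetric self-similar
compressible Euler flows. -/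
theorem emden_transform_of_NLS_profile
    (d : ℕ) (hd : 1 ≤ d) (p : ℝ) (hp : 1 < p) (e : ℝ) (he : e ∈ Set.Ioo (0:ℝ) 1)
    (r μ ℓ : ℝ) (hr : r = 2 / (1 - e)) (hμ : μ = (1 - e) / 2) (hℓ : ℓ = 4 / (p - 1))
    (ρP ΨP : ℝ → ℝ)
    (hρsmooth : ContDiffOn ℝ (⊤ : ℕ∞) ρP (Set.Ioi 0)) (hΨsmooth : ContDiffOn ℝ (⊤ : ℕ∞) ΨP (Set.Ioi 0))
    (hρpos : ∀ Z ∈ Set.Ioi (0:ℝ), 0 < ρP Z)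
    (hprofile1 : ∀ Z ∈ Set.Ioi (0:ℝ),
      (deriv ΨP Z) ^ 2 + ρP Z ^ (p - 1) + μ * (r - 2) * ΨP Z + μ * Z * deriv ΨP Z = 1)
    (hprofile2 : ∀ Z ∈ Set.Ioi (0:ℝ),
      radialLaplacian d ΨP Z + μ * ℓ * (r - 1) / 2
        + (2 * deriv ΨP Z + μ * Z) * (deriv ρP Z / ρP Z) = 0)
    (w σ : ℝ → ℝ)
    (hw : ∀ x : ℝ, deriv ΨP (Real.exp x) = -(μ / 2) * Real.exp x * w x)
    (hσ : ∀ x : ℝ, ρP (Real.exp x) ^ ((p - 1) / 2) = μ * Real.sqrt ℓ / 2 * Real.exp x * σ x) :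
    ∀ x : ℝ,
      ((w x - 1) * deriv w x + ℓ * σ x * deriv σ x
          + (w x ^ 2 - r * w x + ℓ * σ x ^ 2) = 0) ∧
      ((σ x / ℓ) * deriv w x + (w x - 1) * deriv σ x
          + σ x * (((d : ℝ) / ℓ + 1) * w x - r) = 0) := by
  intro x
  have hμ0 : 0 < μ := by rw [hμ]; linarith [he.2]
  have hp1 : 0 < p - 1 := by linarith
  have hℓ0 : 0 < ℓ := by rw [hℓ]; positivity
  set Z := Real.exp x with hZdef
  have hZ : 0 < Z := Real.exp_pos x
  have hnhds : Set.Ioi (0 : ℝ) ∈ nhds Z := Ioi_mem_nhds hZ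
  have hρ : HasDerivAt ρP (deriv ρP Z) Z :=
    ((hρsmooth.contDiffAt hnhds).differentiableAt (by simp)).hasDerivAt
  have hΨ : HasDerivAt ΨP (deriv ΨP Z) Z :=
    ((hΨsmooth.contDiffAt hnhds).differentiableAt (by simp)).hasDerivAt
  have hΨ' : HasDerivAt (deriv ΨP) (deriv (deriv ΨP) Z) Z :=
    (((hΨsmooth.deriv_of_isOpen (m := 1) isOpen_Ioi (by norm_cast)).contDiffAt
      hnhds).differentiableAt (by simp)).hasDerivAt
  have hρZ : 0 < ρP Z := hρpos Z hZ
  have hsqrt : Real.sqrt ℓ ^ 2 = ℓ := Real.sq_sqrt hℓ0.le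
  have hsqrt0 : 0 < Real.sqrt ℓ := Real.sqrt_pos.2 hℓ0
  have hs : HasDerivAt (fun z => ρP z ^ ((p - 1) / 2))
      ((p - 1) / 2 * ρP Z ^ ((p - 1) / 2) * (deriv ρP Z / ρP Z)) Z := by
    convert hρ.rpow_const (p := (p - 1) / 2) (Or.inl hρZ.ne') using 1
    rw [Real.rpow_sub_one hρZ.ne']
    ring
  have hsq : ∀ z ∈ Set.Ioi (0 : ℝ), ρP z ^ (p - 1) = (ρP z ^ ((p - 1) / 2)) ^ 2 := by
    intro z hz
    rw [← Real.rpow_mul_natCast (hρpos z hz).le]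
    congr 1
    push_cast
    ring
  have hdw : deriv w x = deriv (deriv ΨP) Z / (-(μ / 2)) - w x :=
    (hasDerivAt_emden (by linarith : -(μ / 2) < 0).ne hw hΨ').deriv
  have hdσ := (hasDerivAt_emden (by positivity : μ * Real.sqrt ℓ / 2 ≠ 0) hσ hs).deriv
  have hbernoulli : 2 * deriv ΨP Z * deriv (deriv ΨP) Z
      + 2 * ρP Z ^ ((p - 1) / 2) * ((p - 1) / 2 * ρP Z ^ ((p - 1) / 2) * (deriv ρP Z / ρP Z))
      + μ * (r - 2) * deriv ΨP Z + (μ * deriv ΨP Z + μ * Z * deriv (deriv ΨP) Z) = 0 := by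
    have h := ((((hΨ'.pow 2).add (hs.pow 2)).add (hΨ.const_mul (μ * (r - 2)))).add
      (((hasDerivAt_id Z).const_mul μ).mul hΨ'))
    have hconst := h.congr_of_eventuallyEq (f₁ := fun _ => (1 : ℝ)) (by
      filter_upwards [hnhds] with z hz
      have := hprofile1 z hz
      rw [hsq z hz] at this
      simpa using this.symm)
    have := hconst.unique (hasDerivAt_const Z 1)
    simp only [id] at this
    linear_combination this
  have hcontinuity := hprofile2 Z hZ
  rw [radialLaplacian] at hcontinuity
  have hwx := hw x
  have hσx := hσ x
  rw [← hZdef] at hwx hσx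
  rw [hσx] at hdσ hbernoulli
  rw [hwx] at hbernoulli hcontinuity
  generalize deriv (deriv ΨP) Z = v at *
  generalize deriv ρP Z / ρP Z = q at *
  have hpℓ : (p - 1) / 2 = 2 / ℓ := by rw [hℓ]; field_simp; norm_num
  rw [hpℓ] at hdσ hbernoulli
  have hv : v = -(μ / 2) * (deriv w x + w x) := by rw [hdw]; field_simp; ring
  have hqσ : 2 * Z * σ x * q = ℓ * (deriv σ x + σ x) := by rw [hdσ]; field_simp; ring
  rw [hv] at hbernoulli hcontinuity
  generalize deriv w x = w' at *
  generalize deriv σ x = σ' at *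
  clear hdw hdσ hv
  constructor
  · have hfactor : μ ^ 2 * Z / 2 ≠ 0 := by positivity
    have hpressure : 2 * (μ * Real.sqrt ℓ / 2 * Z * σ x) *
        (2 / ℓ * (μ * Real.sqrt ℓ / 2 * Z * σ x) * q) =
          μ ^ 2 * Z * σ x * (ℓ * (σ' + σ x)) / 2 := by
      rw [← hqσ]
      field_simp
      rw [hsqrt]
      ring
    rw [hpressure] at hbernoulli
    refine (mul_eq_zero.1 ?_).resolve_left hfactor
    linear_combination hbernoulli
  · have hfactor : μ * ℓ / 2 ≠ 0 := by positivity
    have hcancel : ((d : ℝ) - 1) / Z * (-(μ / 2) * Z * w x) = -(μ / 2) * ((d : ℝ) - 1) * w x := by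
      field_simp
    rw [hcancel] at hcontinuity
    refine (mul_eq_zero.1 ?_).resolve_left hfactor
    have hexpand : μ * ℓ / 2 * (σ x / ℓ * w' + (w x - 1) * σ' + σ x * ((d / ℓ + 1) * w x - r)) =
        μ / 2 * (σ x * w' + ℓ * (w x - 1) * σ' + σ x * ((d + ℓ) * w x - r * ℓ)) := by
      field_simp
    rw [hexpand]
    linear_combination -σ x * hcontinuity + μ * (1 - w x) / 2 * hqσ
end
end

section
/- Let d ≥ 1 be an integer, γ > 1, e ∈ (0,1). Let ρ, Ψ : (0,∞) → ℝ be smooth with ρ > 0 and suppose they satisfy on (0,∞) the self-similar compressible Euler profile equations ΔΨ + (e/(γ−1) + 1/(γ+1)) + (∂_Zρ/ρ)[((1−e)/2)Z + ∂_ZΨ] = 0 and (1/2)(∂_ZΨ)² + (e − 1/(γ+1))Ψ + ((1−e)/2)Z∂_ZΨ + ρ^{γ−1} = 1. Set S = √2 · ρ^{(γ−1)/2} and define w, σ : ℝ → ℝ by ∂_ZΨ(e^x) = e^x w(x) and S(e^x) = e^x σ(x). Then on ℝ: (w + (1−e)/2)w' + σσ' + (w² + (γ/(γ+1))w + σ²)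 = 0 and σw' + (2/(γ−1))((1−e)/2 + w)σ' + σ[(d + 2/(γ−1))w + 2γ/(γ²−1)] = 0. -/
noncomputable section

/-- If `f (exp x) = exp x * g x`, then `f' (exp x) = g x + g' x`. -/
theorem eq_add_deriv_of_comp_exp_eq {f g : ℝ → ℝ} (h : ∀ x, f (Real.exp x) = Real.exp x * g x)
    {x f' : ℝ} (hf : HasDerivAt f f' (Real.exp x)) : f' = g x + deriv g x := by
  have hg : g = fun y => Real.exp (-y) * f (Real.exp y) := by
    funext y
    rw [h, ← mul_assoc, ← Real.exp_add, neg_add_cancel, Real.exp_zero, one_mul]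
  have hg' : DifferentiableAt ℝ g x := by
    rw [hg]
    exact (Real.differentiable_exp.comp differentiable_neg x).mul
      (hf.comp x (Real.hasDerivAt_exp x)).differentiableAt
  have h1 : HasDerivAt (fun y => f (Real.exp y)) (f' * Real.exp x) x :=
    hf.comp x (Real.hasDerivAt_exp x)
  have h2 : HasDerivAt (fun y => Real.exp y * g y)
      (Real.exp x * g x + Real.exp x * deriv g x) x :=
    (Real.hasDerivAt_exp x).mul hg'.hasDerivAt
  rw [funext h] at h1
  have h3 := h1.unique h2
  apply mul_right_cancel₀ (Real.exp_ne_zero x)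
  linear_combination h3

/-- the Emden transform for the front-renormalized compressible Euler
equations with polytropic law `P = ((γ-1)/γ) ρ^γ` (Lemma A.1). -/
theorem emden_transform_of_euler_profile
    (d : ℕ) (hd : 1 ≤ d) (γ : ℝ) (hγ : 1 < γ) (e : ℝ) (he : e ∈ Set.Ioo (0:ℝ) 1)
    (ρ Ψ : ℝ → ℝ)
    (hρsmooth : ContDiffOn ℝ (⊤ : ℕ∞) ρ (Set.Ioi 0)) (hΨsmooth : ContDiffOn ℝ (⊤ : ℕ∞) Ψ (Set.Ioi 0))
    (hρpos : ∀ Z ∈ Set.Ioi (0:ℝ), 0 < ρ Z)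
    (hprofile1 : ∀ Z ∈ Set.Ioi (0:ℝ),
      radialLaplacian d Ψ Z + (e / (γ - 1) + 1 / (γ + 1))
        + (deriv ρ Z / ρ Z) * ((1 - e) / 2 * Z + deriv Ψ Z) = 0)
    (hprofile2 : ∀ Z ∈ Set.Ioi (0:ℝ),
      (1 / 2) * (deriv Ψ Z) ^ 2 + (e - 1 / (γ + 1)) * Ψ Z
        + (1 - e) / 2 * Z * deriv Ψ Z + ρ Z ^ (γ - 1) = 1)
    (S : ℝ → ℝ) (hS : ∀ Z : ℝ, S Z = Real.sqrt 2 * ρ Z ^ ((γ - 1) / 2))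
    (w σ : ℝ → ℝ)
    (hw : ∀ x : ℝ, deriv Ψ (Real.exp x) = Real.exp x * w x)
    (hσ : ∀ x : ℝ, S (Real.exp x) = Real.exp x * σ x) :
    ∀ x : ℝ,
      ((w x + (1 - e) / 2) * deriv w x + σ x * deriv σ x
          + (w x ^ 2 + γ / (γ + 1) * w x + σ x ^ 2) = 0) ∧
      (σ x * deriv w x + (2 / (γ - 1)) * ((1 - e) / 2 + w x) * deriv σ x
          + σ x * (((d : ℝ) + 2 / (γ - 1)) * w x + 2 * γ / (γ ^ 2 - 1)) = 0) := by
  intro x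
  obtain ⟨Z, hZdef⟩ : ∃ Z, Z = Real.exp x := ⟨_, rfl⟩
  have hZ : 0 < Z := hZdef ▸ Real.exp_pos x
  have hnhds : Set.Ioi (0 : ℝ) ∈ nhds Z := Ioi_mem_nhds hZ
  have hr : 0 < ρ Z := hρpos Z hZ
  have hρ : HasDerivAt ρ (deriv ρ Z) Z :=
    ((hρsmooth.contDiffAt hnhds).differentiableAt (by simp)).hasDerivAt
  have hΨ : HasDerivAt Ψ (deriv Ψ Z) Z :=
    ((hΨsmooth.contDiffAt hnhds).differentiableAt (by simp)).hasDerivAt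
  have hU : HasDerivAt (deriv Ψ) (deriv (deriv Ψ) Z) Z :=
    (((hΨsmooth.deriv_of_isOpen (m := 1) isOpen_Ioi (by
      rw [one_add_one_eq_two]; exact WithTop.coe_le_coe.2 (le_top (a := (2 : ℕ∞))))).contDiffAt
      hnhds).differentiableAt (by simp)).hasDerivAt
  have hSρ : HasDerivAt S (S Z * ((γ - 1) / 2) * (deriv ρ Z / ρ Z)) Z := by
    rw [funext hS]
    refine ((hρ.rpow_const (p := (γ - 1) / 2) (Or.inl hr.ne')).const_mul
      (Real.sqrt 2)).congr_deriv ?_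
    rw [Real.rpow_sub_one hr.ne']
    ring
  have hSsq : ∀ y ∈ Set.Ioi (0 : ℝ), ρ y ^ (γ - 1) = 1 / 2 * S y ^ 2 := by
    intro y hy
    rw [hS, mul_pow, Real.sq_sqrt (by norm_num), ← Real.rpow_natCast, ← Real.rpow_mul
      (hρpos y hy).le]
    norm_num
    ring
  have hw' := eq_add_deriv_of_comp_exp_eq hw (hZdef ▸ hU)
  have hσ' := eq_add_deriv_of_comp_exp_eq hσ (hZdef ▸ hSρ)
  rw [← hZdef] at hw' hσ'
  have hwx := hw x
  have hσx := hσ x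
  rw [← hZdef] at hwx hσx
  have hγ1 : γ - 1 ≠ 0 := by linarith
  have hγ2 : γ + 1 ≠ 0 := by linarith
  constructor
  · have hB := ((((hU.pow 2).const_mul (1 / 2)).add (hΨ.const_mul (e - 1 / (γ + 1)))).add
      (((hasDerivAt_id Z).const_mul ((1 - e) / 2)).mul hU)).add
        ((hSρ.pow 2).const_mul (1 / 2))
    have hB0 := (hB.congr_of_eventuallyEq (f₁ := fun _ => (1 : ℝ)) (by
      filter_upwards [hnhds] with y hy
      have := hprofile2 y hy
      rw [hSsq y hy] at this
      exact this.symm)).unique (hasDerivAt_const Z 1)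
    rw [hσ', hw', hwx, hσx] at hB0
    simp only [id, Nat.cast_ofNat, Nat.reduceSub, pow_one, mul_one] at hB0
    apply mul_left_cancel₀ hZ.ne'
    have hc : γ / (γ + 1) = 1 - 1 / (γ + 1) := by field_simp; ring
    rw [hc]
    linear_combination hB0
  · have h1 := hprofile1 Z hZ
    rw [radialLaplacian, hw', hwx] at h1
    have hq : Z * σ x * ((γ - 1) / 2) * (deriv ρ Z / ρ Z) = σ x + deriv σ x := by
      rw [← hσx]; exact hσ'
    have hd' : ((d : ℝ) - 1) / Z * (Z * w x) = (d - 1) * w x := by field_simp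
    have hk : 2 * γ / (γ ^ 2 - 1) = 1 / (γ - 1) + 1 / (γ + 1) := by
      have : γ ^ 2 - 1 = (γ - 1) * (γ + 1) := by ring
      rw [this]; field_simp; ring
    have hγi : (γ - 1) * (1 / (γ - 1)) = 1 := by field_simp
    rw [hd'] at h1
    rw [hk]
    linear_combination σ x * h1 - 2 / (γ - 1) * ((1 - e) / 2 + w x) * hq
      + (Z * σ x * (deriv ρ Z / ρ Z) * ((1 - e) / 2 + w x)) * hγi
end
end

section
/- Let d ≥ 1 and k ≥ 1 be integers. There exist real constants c_{k,α,β}, indexed by pairs of multi-indices α, β ∈ ℕ^d with |α| + |β| = 2k and |β| ≤ 2k−2, such that for all smooth functions V, Φ : ℝ^d → ℝ, Δ^k(VΦ) − V Δ^kΦ − 2k ∇V·∇(Δ^{k−1}Φ) = Σ_{|α|+|β|=2k, |β|≤2k−2} c_{k,α,β} (∂^α V)(∂^β Φ). -/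
noncomputable section

/-- Partial derivative in the `i`-th coordinate direction on ℝ^d. -/
def coordDeriv (d : ℕ) (i : Fin d) (f : EuclideanSpace ℝ (Fin d) → ℝ) :
    EuclideanSpace ℝ (Fin d) → ℝ :=
  fun x => fderiv ℝ f x (EuclideanSpace.single i 1)

/-- Laplacian on ℝ^d. -/
def euclideanLaplacian (d : ℕ) (f : EuclideanSpace ℝ (Fin d) → ℝ) :
    EuclideanSpace ℝ (Fin d) → ℝ :=
  fun x => ∑ i, coordDeriv d i (coordDeriv d i f) x

/-- Iterated partial derivative `∂^α = ∂_1^{α_1} ⋯ ∂_d^{α_d}` for a multi-index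
`α : Fin d → ℕ`. -/
def multiDeriv (d : ℕ) (α : Fin d → ℕ) (f : EuclideanSpace ℝ (Fin d) → ℝ) :
    EuclideanSpace ℝ (Fin d) → ℝ :=
  (List.finRange d).foldl (fun g i => (coordDeriv d i)^[α i] g) f

section CommutingDerivations

variable {R A ι : Type*} [CommRing R] [CommRing A] [Algebra R A]

/-- Successive application of the derivations `D i`, for `i` running through the word `w`. -/
def wordDeriv (D : ι → Derivation R A A) (w : List ι) (a : A) : A :=
  w.foldl (fun b i => D i b) a

/-- The sum of squares `∑ i, D i ∘ D i` of a finite family of derivations. -/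
def sumSqDeriv [Fintype ι] (D : ι → Derivation R A A) : A →ₗ[R] A :=
  ∑ i, (D i).toLinearMap ∘ₗ (D i).toLinearMap

/-- The span of the bidifferential monomials of total order `N` whose order in the first argument
is at least two. -/
def bidiffSpan (D : ι → Derivation R A A) (N : ℕ) : Submodule R (A → A → A) :=
  Submodule.span R {F | ∃ u v : List ι, u.length + v.length = N ∧ 2 ≤ u.length ∧
    F = fun a b => wordDeriv D u a * wordDeriv D v b}

theorem deriv_wordDeriv (D : ι → Derivation R A A) (i : ι) (w : List ι) (a : A) :
    D i (wordDeriv D w a) = wordDeriv D (w ++ [i]) a := by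
  simp [wordDeriv]

theorem wordDeriv_sum (D : ι → Derivation R A A) (w : List ι) {κ : Type*} (s : Finset κ)
    (f : κ → A) : wordDeriv D w (∑ j ∈ s, f j) = ∑ j ∈ s, wordDeriv D w (f j) := by
  induction w generalizing f with
  | nil => rfl
  | cons i w ih => simpa [wordDeriv] using ih fun j => D i (f j)

theorem wordDeriv_eq_of_perm (D : ι → Derivation R A A)
    (hD : ∀ i j a, D i (D j a) = D j (D i a)) {u v : List ι} (h : u.Perm v) (a : A) :
    wordDeriv D u a = wordDeriv D v a :=
  h.foldl_eq' (fun i _ j _ b => hD j i b) a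

theorem wordDeriv_eq_foldl_count [DecidableEq ι] (D : ι → Derivation R A A)
    (hD : ∀ i j a, D i (D j a) = D j (D i a)) {l : List ι} (hl : l.Nodup) (hmem : ∀ i, i ∈ l)
    (w : List ι) (a : A) :
    wordDeriv D w a = l.foldl (fun b i => (D i)^[w.count i] b) a := by
  have hperm : w.Perm (l.flatMap fun i => List.replicate (w.count i) i) := by
    rw [List.perm_iff_count]
    intro j
    rw [List.count_flatMap]
    have hcount : (List.count j ∘ fun i => List.replicate (w.count i) i) =
        fun i => if i = j then w.count i else 0 := by
      ext i
      simp [List.count_replicate]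
    rw [hcount, ← List.sum_toFinset _ hl]
    simp [hmem]
  have hrep : ∀ (n : ℕ) (i : ι) (b : A),
      (List.replicate n i).foldl (fun c j => D j c) b = (D i)^[n] b := by
    intro n i
    induction n with
    | zero => intro b; rfl
    | succ n ih => intro b; simpa [List.replicate_succ] using ih (D i b)
  rw [wordDeriv_eq_of_perm D hD hperm, wordDeriv, List.foldl_flatMap]
  simp only [hrep]

theorem deriv_mem_bidiffSpan (D : ι → Derivation R A A) (i : ι) {N : ℕ} {F : A → A → A}
    (hF : F ∈ bidiffSpan D N) : (fun a b => D i (F a b)) ∈ bidiffSpan D (N + 1) := by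
  induction hF using Submodule.span_induction with
  | mem F hF =>
    obtain ⟨u, v, hN, hu, rfl⟩ := hF
    have h₁ : (fun a b => wordDeriv D u a * wordDeriv D (v ++ [i]) b) ∈ bidiffSpan D (N + 1) :=
      Submodule.subset_span ⟨u, v ++ [i], by simp; omega, hu, rfl⟩
    have h₂ : (fun a b => wordDeriv D (u ++ [i]) a * wordDeriv D v b) ∈ bidiffSpan D (N + 1) :=
      Submodule.subset_span ⟨u ++ [i], v, by simp; omega, by simp; omega, rfl⟩
    convert add_mem h₁ h₂ using 1
    funext a b
    simp only [Derivation.leibniz, deriv_wordDeriv, smul_eq_mul, Pi.add_apply]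
    ring
  | zero =>
    simp only [Pi.zero_apply, map_zero]
    exact zero_mem _
  | add F G _ _ hF hG =>
    simp only [Pi.add_apply, map_add]
    exact add_mem hF hG
  | smul r F _ hF =>
    simp only [Pi.smul_apply, Derivation.map_smul]
    exact Submodule.smul_mem _ r hF

variable [Fintype ι]

theorem sumSqDeriv_apply (D : ι → Derivation R A A) (a : A) :
    sumSqDeriv D a = ∑ i, D i (D i a) := by
  simp [sumSqDeriv]

theorem sumSqDeriv_mul (D : ι → Derivation R A A) (a b : A) :
    sumSqDeriv D (a * b) =
      sumSqDeriv D a * b + a * sumSqDeriv D b + 2 * ∑ i, D i a * D i b := by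
  simp only [sumSqDeriv_apply, Finset.sum_mul, Finset.mul_sum, ← Finset.sum_add_distrib]
  refine Finset.sum_congr rfl fun i _ => ?_
  simp only [Derivation.leibniz, smul_eq_mul, map_add]
  ring

theorem deriv_sumSqDeriv (D : ι → Derivation R A A)
    (hD : ∀ i j a, D i (D j a) = D j (D i a)) (i : ι) (a : A) :
    D i (sumSqDeriv D a) = sumSqDeriv D (D i a) := by
  simp only [sumSqDeriv_apply, map_sum]
  exact Finset.sum_congr rfl fun j _ => by rw [hD i j, hD i j]

theorem sumSqDeriv_mem_bidiffSpan (D : ι → Derivation R A A) {N : ℕ} {F : A → A → A}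
    (hF : F ∈ bidiffSpan D N) : (fun a b => sumSqDeriv D (F a b)) ∈ bidiffSpan D (N + 2) := by
  convert sum_mem fun i (_ : i ∈ Finset.univ) =>
    deriv_mem_bidiffSpan D i (deriv_mem_bidiffSpan D i hF) using 1
  funext a b
  simp [sumSqDeriv_apply]

theorem wordDeriv_mul_iterate_mem_bidiffSpan (D : ι → Derivation R A A) {u : List ι}
    (hu : 2 ≤ u.length) (v : List ι) {k N : ℕ} (hN : u.length + v.length + 2 * k = N) :
    (fun a b => wordDeriv D u a * wordDeriv D v ((sumSqDeriv D)^[k] b)) ∈ bidiffSpan D N := by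
  induction k generalizing v with
  | zero => exact Submodule.subset_span ⟨u, v, hN, hu, rfl⟩
  | succ k ih =>
    convert (bidiffSpan D N).sum_mem fun i (_ : i ∈ Finset.univ) =>
      ih (i :: i :: v) (by simp only [List.length_cons]; omega) using 1
    funext a b
    simp only [Function.iterate_succ_apply', sumSqDeriv_apply D ((sumSqDeriv D)^[k] b),
      wordDeriv_sum, Finset.mul_sum, Finset.sum_apply]
    rfl

theorem iterate_sumSqDeriv_commutator_mem_bidiffSpan (D : ι → Derivation R A A)
    (hD : ∀ i j a, D i (D j a) = D j (D i a)) (k : ℕ) :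
    (fun a b => (sumSqDeriv D)^[k + 1] (a * b) - a * (sumSqDeriv D)^[k + 1] b
        - 2 * ((k + 1 : ℕ) : A) * ∑ i, D i a * D i ((sumSqDeriv D)^[k] b)) ∈
      bidiffSpan D (2 * (k + 1)) := by
  have hlap (k : ℕ) : (fun a b => sumSqDeriv D a * (sumSqDeriv D)^[k] b) ∈
      bidiffSpan D (2 * (k + 1)) := by
    convert (bidiffSpan D (2 * (k + 1))).sum_mem fun i (_ : i ∈ Finset.univ) =>
      wordDeriv_mul_iterate_mem_bidiffSpan D (u := [i, i]) le_rfl []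
        (k := k) (by simp only [List.length_cons, List.length_nil]; omega) using 1
    funext a b
    simp [wordDeriv, sumSqDeriv_apply D a, Finset.sum_mul]
  induction k with
  | zero =>
    convert hlap 0 using 1
    funext a b
    simp only [Function.iterate_succ, Function.iterate_zero, Function.comp_apply, id_eq,
      sumSqDeriv_mul]
    push_cast
    ring
  | succ k ih =>
    have hgrad : (fun a b => ∑ i, sumSqDeriv D (D i a) * D i ((sumSqDeriv D)^[k] b)) ∈
        bidiffSpan D (2 * (k + 1 + 1)) := by
      convert (bidiffSpan D (2 * (k + 1 + 1))).sum_mem fun i (_ : i ∈ Finset.univ) =>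
        Submodule.sum_mem _ fun j (_ : j ∈ Finset.univ) =>
          wordDeriv_mul_iterate_mem_bidiffSpan D (u := [i, j, j]) (by simp) [i] (k := k)
            (by simp only [List.length_cons, List.length_nil]; omega) using 1
      funext a b
      simp [wordDeriv, sumSqDeriv_apply D (D _ a), Finset.sum_mul]
    have hhess : (fun a b => ∑ i, ∑ j, D j (D i a) * D j (D i ((sumSqDeriv D)^[k] b))) ∈
        bidiffSpan D (2 * (k + 1 + 1)) := by
      convert (bidiffSpan D (2 * (k + 1 + 1))).sum_mem fun i (_ : i ∈ Finset.univ) =>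
        Submodule.sum_mem _ fun j (_ : j ∈ Finset.univ) =>
          wordDeriv_mul_iterate_mem_bidiffSpan D (u := [i, j]) le_rfl [i, j] (k := k)
            (by simp only [List.length_cons, List.length_nil]; omega) using 1
      funext a b
      simp [wordDeriv]
    have hsum := add_mem (add_mem (sumSqDeriv_mem_bidiffSpan D ih) (hlap (k + 1)))
      (add_mem (Submodule.smul_mem _ (2 * ((k + 1 : ℕ) : R)) hgrad)
        (Submodule.smul_mem _ (4 * ((k + 1 : ℕ) : R)) hhess))
    rw [show 2 * (k + 1 + 1) = 2 * (k + 1) + 2 by ring]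
    convert hsum using 1
    funext a b
    have hconst (n : ℕ) (x : A) : sumSqDeriv D ((n : A) * x) = (n : A) * sumSqDeriv D x := by
      rw [← nsmul_eq_mul, map_nsmul, nsmul_eq_mul]
    have h₁ := hconst (2 * (k + 1))
    have hgradmul (c : A) : sumSqDeriv D (∑ i, D i a * D i c) =
        ∑ i, sumSqDeriv D (D i a) * D i c + ∑ i, D i a * D i (sumSqDeriv D c)
          + 2 * ∑ i, ∑ j, D j (D i a) * D j (D i c) := by
      simp only [map_sum, sumSqDeriv_mul, deriv_sumSqDeriv D hD, Finset.sum_add_distrib,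
        Finset.mul_sum]
    have hsmul (r : ℕ) (x : A) : (r : R) • x = (r : A) * x := by
      rw [Nat.cast_smul_eq_nsmul, nsmul_eq_mul]
    have h₂ := hsmul (2 * (k + 1))
    have h₄ := hsmul (4 * (k + 1))
    push_cast at h₁ h₂ h₄
    simp only [Pi.add_apply, Pi.smul_apply, map_sub, Nat.cast_add, Nat.cast_one, h₁, h₂, h₄,
      hgradmul, sumSqDeriv_mul D a, Function.iterate_succ_apply' _ (k + 1),
      Function.iterate_succ_apply' _ k]
    ring

end CommutingDerivations

theorem contDiff_coordDeriv {d : ℕ} (i : Fin d) {f : EuclideanSpace ℝ (Fin d) → ℝ}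
    (hf : ContDiff ℝ (⊤ : ℕ∞) f) : ContDiff ℝ (⊤ : ℕ∞) (coordDeriv d i f) :=
  (hf.fderiv_right (by simp)).clm_apply contDiff_const

theorem coordDeriv_comm {d : ℕ} (i j : Fin d) {f : EuclideanSpace ℝ (Fin d) → ℝ}
    (hf : ContDiff ℝ (⊤ : ℕ∞) f) :
    coordDeriv d i (coordDeriv d j f) = coordDeriv d j (coordDeriv d i f) := by
  have hd : Differentiable ℝ (fderiv ℝ f) :=
    (hf.fderiv_right (m := (⊤ : ℕ∞)) (by simp)).differentiable (by simp)
  have hsecond (i j : Fin d) (x : EuclideanSpace ℝ (Fin d)) :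
      coordDeriv d i (coordDeriv d j f) x =
        fderiv ℝ (fderiv ℝ f) x (EuclideanSpace.single i 1) (EuclideanSpace.single j 1) := by
    change fderiv ℝ (fun y => fderiv ℝ f y (EuclideanSpace.single j 1)) x _ = _
    rw [fderiv_clm_apply (hd x) (differentiableAt_const _)]
    simp
  funext x
  rw [hsecond, hsecond]
  exact (hf.contDiffAt.isSymmSndFDerivAt (by simpa using WithTop.coe_le_coe.2 (le_top : (2 : ℕ∞) ≤ ⊤))) _ _

/-- The algebra of smooth real-valued functions on ℝ^d. -/
def smoothSubalgebra (d : ℕ) : Subalgebra ℝ (EuclideanSpace ℝ (Fin d) → ℝ) where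
  carrier := {f | ContDiff ℝ (⊤ : ℕ∞) f}
  mul_mem' := by
    intro f g hf hg
    rw [Set.mem_ofPred_eq] at *
    exact hf.mul hg
  add_mem' := by
    intro f g hf hg
    rw [Set.mem_ofPred_eq] at *
    exact hf.add hg
  algebraMap_mem' c := by
    rw [Set.mem_ofPred_eq]
    exact contDiff_const

theorem contDiff_coe_smoothSubalgebra {d : ℕ} (f : smoothSubalgebra d) :
    ContDiff ℝ (⊤ : ℕ∞) (f : EuclideanSpace ℝ (Fin d) → ℝ) :=
  f.2

theorem differentiable_coe_smoothSubalgebra {d : ℕ} (f : smoothSubalgebra d) :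
    Differentiable ℝ (f : EuclideanSpace ℝ (Fin d) → ℝ) :=
  (contDiff_coe_smoothSubalgebra f).differentiable (by simp)

/-- The coordinate derivative as a derivation of the algebra of smooth functions. -/
def coordDerivation (d : ℕ) (i : Fin d) :
    Derivation ℝ (smoothSubalgebra d) (smoothSubalgebra d) :=
  Derivation.mk'
    { toFun := fun f => ⟨coordDeriv d i f, contDiff_coordDeriv i (contDiff_coe_smoothSubalgebra f)⟩
      map_add' := fun f g => by
        ext x
        have hf := differentiable_coe_smoothSubalgebra f x
        have hg := differentiable_coe_smoothSubalgebra g x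
        simp [coordDeriv, fderiv_add hf hg]
      map_smul' := fun c f => by
        ext x
        have hf := differentiable_coe_smoothSubalgebra f x
        simp [coordDeriv, fderiv_const_smul hf] }
    fun f g => by
      ext x
      have hf := differentiable_coe_smoothSubalgebra f x
      have hg := differentiable_coe_smoothSubalgebra g x
      simp [coordDeriv, fderiv_mul hf hg]

theorem coe_coordDerivation {d : ℕ} (i : Fin d) (f : smoothSubalgebra d) :
    (coordDerivation d i f : EuclideanSpace ℝ (Fin d) → ℝ) = coordDeriv d i f :=
  rfl

theorem coordDerivation_comm {d : ℕ} (i j : Fin d) (f : smoothSubalgebra d) :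
    coordDerivation d i (coordDerivation d j f) = coordDerivation d j (coordDerivation d i f) :=
  Subtype.ext (coordDeriv_comm i j (contDiff_coe_smoothSubalgebra f))

theorem coe_iterate_sumSqDeriv_coordDerivation {d : ℕ} (k : ℕ) (f : smoothSubalgebra d) :
    ((sumSqDeriv (coordDerivation d))^[k] f : EuclideanSpace ℝ (Fin d) → ℝ) =
      (euclideanLaplacian d)^[k] f := by
  refine Function.Semiconj.iterate_right (f := Subtype.val) (fun g => ?_) k f
  funext x
  simp [sumSqDeriv_apply, euclideanLaplacian, coe_coordDerivation]

theorem coe_wordDeriv_coordDerivation {d : ℕ} (w : List (Fin d)) (f : smoothSubalgebra d) :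
    (↑(wordDeriv (coordDerivation d) w f) : EuclideanSpace ℝ (Fin d) → ℝ) =
      multiDeriv d (fun i => w.count i) f := by
  rw [wordDeriv_eq_foldl_count (coordDerivation d) coordDerivation_comm (List.nodup_finRange d) List.mem_finRange,
    multiDeriv]
  refine (List.foldl_hom Subtype.val fun g i => ?_).symm
  exact (Function.Semiconj.iterate_right (f := Subtype.val)
    (fun h => coe_coordDerivation i h) (w.count i) g).symm

/-- Bidifferential operators of total order `2 * k` and order at least two in the first argument
are combinations of products of multi-index derivatives. -/
theorem exists_coeff_of_mem_bidiffSpan {d k : ℕ}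
    {F : smoothSubalgebra d → smoothSubalgebra d → smoothSubalgebra d}
    (hF : F ∈ bidiffSpan (coordDerivation d) (2 * k)) :
    ∃ c : (Fin d → Fin (2 * k + 1)) → (Fin d → Fin (2 * k + 1)) → ℝ,
      ∀ (V Φ : smoothSubalgebra d) (x : EuclideanSpace ℝ (Fin d)),
        (F V Φ : EuclideanSpace ℝ (Fin d) → ℝ) x =
          ∑ α : Fin d → Fin (2 * k + 1), ∑ β : Fin d → Fin (2 * k + 1),
            if (∑ i, (α i : ℕ)) + (∑ i, (β i : ℕ)) = 2 * k
                ∧ (∑ i, (β i : ℕ)) ≤ 2 * k - 2 then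
              c α β * multiDeriv d (fun i => (α i : ℕ)) V x
                * multiDeriv d (fun i => (β i : ℕ)) Φ x
            else 0 := by
  induction hF using Submodule.span_induction with
  | mem F hF =>
    obtain ⟨u, v, hN, hu, rfl⟩ := hF
    have hlen (w : List (Fin d)) : ∑ i, w.count i = w.length := by
      simpa using Multiset.sum_count_eq_card (s := Finset.univ) (m := (w : Multiset (Fin d)))
        fun a _ => Finset.mem_univ a
    let α₀ : Fin d → Fin (2 * k + 1) :=
      fun i => ⟨u.count i, by have := u.count_le_length (a := i); omega⟩
    let β₀ : Fin d → Fin (2 * k + 1) :=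
      fun i => ⟨v.count i, by have := v.count_le_length (a := i); omega⟩
    refine ⟨fun α β => if α = α₀ then if β = β₀ then 1 else 0 else 0, fun V Φ x => ?_⟩
    rw [Finset.sum_eq_single α₀ (fun α _ hα => by simp [hα]) (by simp),
      Finset.sum_eq_single β₀ (fun β _ hβ => by simp [hβ]) (by simp), if_pos]
    · simp [coe_wordDeriv_coordDerivation, α₀, β₀]
    · simp only [α₀, β₀, hlen]
      omega
  | zero => exact ⟨0, by simp⟩
  | add F G _ _ hF hG =>
    obtain ⟨c, hc⟩ := hF
    obtain ⟨c', hc'⟩ := hG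
    refine ⟨c + c', fun V Φ x => ?_⟩
    simp only [Pi.add_apply, Subalgebra.coe_add, hc, hc', ← Finset.sum_add_distrib]
    refine Finset.sum_congr rfl fun α _ => Finset.sum_congr rfl fun β _ => ?_
    split_ifs <;> ring
  | smul r F _ hF =>
    obtain ⟨c, hc⟩ := hF
    refine ⟨r • c, fun V Φ x => ?_⟩
    simp only [Pi.smul_apply, Subalgebra.coe_smul, hc, smul_eq_mul, Finset.mul_sum]
    refine Finset.sum_congr rfl fun α _ => Finset.sum_congr rfl fun β _ => ?_
    split_ifs <;> ring

/-- commutator structure lemma for `Δ^k` (Lemma C.1). There are constants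
`c_{k,α,β}` for multi-indices with `|α| + |β| = 2k`, `|β| ≤ 2k - 2`, such that for all
smooth `V, Φ`,
`Δ^k(VΦ) - V Δ^kΦ - 2k ∇V·∇(Δ^{k-1}Φ) = Σ c_{k,α,β} (∂^α V)(∂^β Φ)`. -/
theorem iterated_laplacian_commutator (d k : ℕ) (hd : 1 ≤ d) (hk : 1 ≤ k) :
    ∃ c : (Fin d → Fin (2 * k + 1)) → (Fin d → Fin (2 * k + 1)) → ℝ,
      ∀ V Φ : EuclideanSpace ℝ (Fin d) → ℝ, ContDiff ℝ (⊤ : ℕ∞) V → ContDiff ℝ (⊤ : ℕ∞) Φ →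
        ∀ x : EuclideanSpace ℝ (Fin d),
          (euclideanLaplacian d)^[k] (fun y => V y * Φ y) x
              - V x * (euclideanLaplacian d)^[k] Φ x
              - 2 * (k : ℝ) *
                  ∑ i, coordDeriv d i V x * coordDeriv d i ((euclideanLaplacian d)^[k - 1] Φ) x
            = ∑ α : Fin d → Fin (2 * k + 1), ∑ β : Fin d → Fin (2 * k + 1),
                if (∑ i, (α i : ℕ)) + (∑ i, (β i : ℕ)) = 2 * k
                    ∧ (∑ i, (β i : ℕ)) ≤ 2 * k - 2 then
                  c α β * multiDeriv d (fun i => (α i : ℕ)) V x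
                    * multiDeriv d (fun i => (β i : ℕ)) Φ x
                else 0 := by
  obtain ⟨k, rfl⟩ : ∃ m, k = m + 1 := ⟨k - 1, by omega⟩
  obtain ⟨c, hc⟩ := exists_coeff_of_mem_bidiffSpan
    (iterate_sumSqDeriv_commutator_mem_bidiffSpan (coordDerivation d) coordDerivation_comm k)
  refine ⟨c, fun V Φ hV hΦ x => ?_⟩
  rw [← hc ⟨V, hV⟩ ⟨Φ, hΦ⟩ x]
  simp only [Subalgebra.coe_sub, Subalgebra.coe_mul, Pi.sub_apply, Pi.mul_apply,
    AddSubmonoidClass.coe_finsetSum, Finset.sum_apply, coe_coordDerivation,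
    coe_iterate_sumSqDeriv_coordDerivation]
  rfl
end
end

section
/- Let d ≥ 1 be an integer. For all smooth radial functions f, g on ℝ^d with g compactly supported, ∫_{ℝ^d} f Δg ∂_r g dx = −(1/2) ∫_{ℝ^d} |∂_r g|² (∂_r f − ((d−1)/|x|) f) dx, where ∂_r denotes the radial derivative. -/
open MeasureTheory

noncomputable section

theorem hasFDerivAt_norm_of_ne_zero {E : Type*} [NormedAddCommGroup E] [InnerProductSpace ℝ E]
    {x : E} (hx : x ≠ 0) : HasFDerivAt (fun y : E => ‖y‖) (‖x‖⁻¹ • innerSL ℝ x) x := by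
  have hsq : ‖x‖ ^ 2 ≠ 0 := by positivity
  have h := (hasStrictFDerivAt_norm_sq x).hasFDerivAt.sqrt hsq
  simp only [Real.sqrt_sq (norm_nonneg _)] at h
  convert h using 1
  ext y
  have : ‖x‖ ≠ 0 := norm_ne_zero_iff.2 hx
  simp
  field_simp

theorem coordDeriv_comp_norm {d : ℕ} {γ : ℝ → ℝ} {c : ℝ} {x : EuclideanSpace ℝ (Fin d)}
    (hx : x ≠ 0) (hγ : HasDerivAt γ c ‖x‖) (i : Fin d) :
    coordDeriv d i (fun y => γ ‖y‖) x = c * (x i / ‖x‖) := by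
  have h : HasFDerivAt (fun y : EuclideanSpace ℝ (Fin d) => γ ‖y‖) _ x :=
    hγ.comp_hasFDerivAt x (hasFDerivAt_norm_of_ne_zero hx)
  rw [coordDeriv, h.fderiv]
  simp [EuclideanSpace.inner_single_right, div_eq_inv_mul]

theorem euclideanLaplacian_comp_norm {d : ℕ} {γ : ℝ → ℝ} (hγ : ContDiff ℝ 2 γ)
    {x : EuclideanSpace ℝ (Fin d)} (hx : x ≠ 0) :
    euclideanLaplacian d (fun y => γ ‖y‖) x =
      deriv (deriv γ) ‖x‖ + ((d : ℝ) - 1) / ‖x‖ * deriv γ ‖x‖ := by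
  have hx' : ‖x‖ ≠ 0 := norm_ne_zero_iff.2 hx
  have hγ' : ContDiff ℝ 1 (deriv γ) := hγ.deriv'
  have hγd : Differentiable ℝ γ := hγ.differentiable (by norm_num)
  have hγd' : Differentiable ℝ (deriv γ) := hγ'.differentiable (by norm_num)
  have key : ∀ i, coordDeriv d i (coordDeriv d i (fun y => γ ‖y‖)) x =
      (deriv (deriv γ) ‖x‖ / ‖x‖ ^ 2 - deriv γ ‖x‖ / ‖x‖ ^ 3) * x i ^ 2
        + deriv γ ‖x‖ / ‖x‖ := by
    intro i
    have heq : coordDeriv d i (fun y => γ ‖y‖) =ᶠ[nhds x]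
        fun y => deriv γ ‖y‖ / ‖y‖ * y i := by
      filter_upwards [isOpen_ne.mem_nhds hx] with y hy
      rw [coordDeriv_comp_norm hy (hγd _).hasDerivAt]
      ring
    have hq : HasDerivAt (fun r => deriv γ r / r) _ ‖x‖ :=
      (hγd' ‖x‖).hasDerivAt.div (hasDerivAt_id _) hx'
    have h1 : HasFDerivAt (fun y : EuclideanSpace ℝ (Fin d) => deriv γ ‖y‖ / ‖y‖) _ x :=
      hq.comp_hasFDerivAt x (hasFDerivAt_norm_of_ne_zero hx)
    have h2 : HasFDerivAt (fun y : EuclideanSpace ℝ (Fin d) => y i) _ x :=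
      (EuclideanSpace.proj (𝕜 := ℝ) i).hasFDerivAt
    have h3 : HasFDerivAt
        (fun y : EuclideanSpace ℝ (Fin d) => deriv γ ‖y‖ / ‖y‖ * y i) _ x := h1.mul h2
    rw [coordDeriv, heq.fderiv_eq, h3.fderiv]
    simp [EuclideanSpace.inner_single_right]
    field_simp
    ring
  rw [euclideanLaplacian, Finset.sum_congr rfl fun i _ => key i, Finset.sum_add_distrib,
    ← Finset.mul_sum, ← EuclideanSpace.real_norm_sq_eq]
  simp
  field_simp
  ring

theorem integral_Ioi_radial_pohozaev (n : ℕ) {φ γ : ℝ → ℝ} (hφ : ContDiff ℝ 1 φ)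
    (hγ : ContDiff ℝ 2 γ) (hγc : HasCompactSupport γ) (hγ0 : deriv γ 0 = 0) :
    ∫ r in Set.Ioi (0 : ℝ), (r ^ n * φ r * deriv (deriv γ) r
        + n * r ^ (n - 1) * φ r * deriv γ r) * deriv γ r =
      -(1 / 2) * ∫ r in Set.Ioi (0 : ℝ),
        (r ^ n * deriv φ r - n * r ^ (n - 1) * φ r) * deriv γ r * deriv γ r := by
  have hγ' : ContDiff ℝ 1 (deriv γ) := hγ.deriv'
  have hc1 : Continuous (deriv γ) := hγ'.continuous
  have hc2 : Continuous (deriv (deriv γ)) := hγ'.continuous_deriv le_rfl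
  have hc3 : Continuous (deriv φ) := hφ.continuous_deriv le_rfl
  have hc4 : Continuous φ := hφ.continuous
  have hsupp : HasCompactSupport (deriv γ) := hγc.deriv
  have hderiv : ∀ r, deriv (fun r => 1 / 2 * r ^ n * φ r * deriv γ r * deriv γ r) r =
      (r ^ n * φ r * deriv (deriv γ) r + n * r ^ (n - 1) * φ r * deriv γ r) * deriv γ r +
        1 / 2 * ((r ^ n * deriv φ r - n * r ^ (n - 1) * φ r) * deriv γ r * deriv γ r) := by
    intro r
    have hφr := (hφ.differentiable (by norm_num) r).hasDerivAt
    have hγr := (hγ'.differentiable (by norm_num) r).hasDerivAt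
    refine (((((hasDerivAt_pow n r).const_mul (1 / 2)).mul hφr).mul hγr).mul hγr).deriv.trans ?_
    simp only [Pi.mul_apply]
    ring
  have hP : ContDiff ℝ 1 fun r => 1 / 2 * r ^ n * φ r * deriv γ r * deriv γ r := by fun_prop
  have hint := HasCompactSupport.integral_Ioi_deriv_eq hP hsupp.mul_left 0
  simp only [hderiv, hγ0, mul_zero, neg_zero] at hint
  rw [integral_add, integral_const_mul] at hint
  · linarith
  · exact (Continuous.integrable_of_hasCompactSupport (by fun_prop) hsupp.mul_left).integrableOn
  · exact ((Continuous.integrable_of_hasCompactSupport (by fun_prop)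
      hsupp.mul_left).const_mul _).integrableOn

/-- the spherically symmetric Pohozaev identity. For smooth radial
`f, g` on ℝ^d with `g` compactly supported (with radial profiles `F, G`),
`∫ f Δg ∂_r g = -(1/2) ∫ |∂_r g|² (∂_r f - ((d-1)/|x|) f)`. -/
theorem pohozaev_identity_radial (d : ℕ) (hd : 1 ≤ d)
    (f g : EuclideanSpace ℝ (Fin d) → ℝ)
    (hf : ContDiff ℝ (⊤ : ℕ∞) f) (hg : ContDiff ℝ (⊤ : ℕ∞) g) (hgc : HasCompactSupport g)
    (F G : ℝ → ℝ)
    (hfF : ∀ x : EuclideanSpace ℝ (Fin d), f x = F ‖x‖)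
    (hgG : ∀ x : EuclideanSpace ℝ (Fin d), g x = G ‖x‖) :
    ∫ x, f x * euclideanLaplacian d g x * deriv G ‖x‖ =
      -(1 / 2) * ∫ x, (deriv G ‖x‖) ^ 2
          * (deriv F ‖x‖ - ((d : ℝ) - 1) / ‖x‖ * f x) := by
  obtain ⟨n, rfl⟩ : ∃ n, d = n + 1 := ⟨d - 1, by omega⟩
  set e : EuclideanSpace ℝ (Fin (n + 1)) := EuclideanSpace.single 0 1 with he
  have hen : ‖e‖ = 1 := by simp [he]
  have he0 : e ≠ 0 := norm_ne_zero_iff.1 (by simp [hen])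
  set φ : ℝ → ℝ := fun r => f (r • e) with hφ_def
  set γ : ℝ → ℝ := fun r => g (r • e) with hγ_def
  have hφ : ContDiff ℝ (⊤ : ℕ∞) φ := hf.comp (by fun_prop)
  have hγ : ContDiff ℝ (⊤ : ℕ∞) γ := hg.comp (by fun_prop)
  have hφ1 : ContDiff ℝ 1 φ := mod_cast contDiff_infty.1 hφ 1
  have hγ2 : ContDiff ℝ 2 γ := mod_cast contDiff_infty.1 hγ 2
  have hγc : HasCompactSupport γ := hgc.comp_isClosedEmbedding (isClosedEmbedding_smul_left he0)
  have hφF : ∀ r, φ r = F |r| := fun r => by simp [hφ_def, hfF, norm_smul, hen]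
  have hγG : ∀ r, γ r = G |r| := fun r => by simp [hγ_def, hgG, norm_smul, hen]
  clear_value φ γ
  have hdF : ∀ r, 0 < r → deriv F r = deriv φ r := fun r hr =>
    Filter.EventuallyEq.deriv_eq <| by
      filter_upwards [lt_mem_nhds hr] with s hs
      rw [hφF, abs_of_pos hs]
  have hdG : ∀ r, 0 < r → deriv G r = deriv γ r := fun r hr =>
    Filter.EventuallyEq.deriv_eq <| by
      filter_upwards [lt_mem_nhds hr] with s hs
      rw [hγG, abs_of_pos hs]
  have hγ0 : deriv γ 0 = 0 := by
    have h := deriv_comp_neg γ 0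
    rw [show (fun r => γ (-r)) = γ from funext fun r => by rw [hγG, hγG, abs_neg], neg_zero] at h
    linarith
  have hfφ : ∀ x, f x = φ ‖x‖ := fun x => by rw [hφF, abs_norm, hfF]
  have hgγ : g = fun x => γ ‖x‖ := funext fun x => by rw [hγG, abs_norm, hgG]
  have hL : ∫ x, f x * euclideanLaplacian (n + 1) g x * deriv G ‖x‖ =
      ∫ x : EuclideanSpace ℝ (Fin (n + 1)),
        φ ‖x‖ * (deriv (deriv γ) ‖x‖ + n / ‖x‖ * deriv γ ‖x‖) * deriv γ ‖x‖ := by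
    refine integral_congr_ae ?_
    filter_upwards [compl_mem_ae_iff.2 (measure_singleton 0)] with x hx
    rw [hfφ, hgγ, euclideanLaplacian_comp_norm hγ2 hx, hdG _ (norm_pos_iff.2 hx)]
    simp
  have hR : ∫ x, (deriv G ‖x‖) ^ 2 * (deriv F ‖x‖ - (((n + 1 : ℕ) : ℝ) - 1) / ‖x‖ * f x) =
      ∫ x : EuclideanSpace ℝ (Fin (n + 1)),
        deriv G ‖x‖ ^ 2 * (deriv F ‖x‖ - n / ‖x‖ * φ ‖x‖) := by
    simp [hfφ]
  have hpow : ∀ r : ℝ, 0 < r → r ^ n * (n / r) = n * r ^ (n - 1) := by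
    intro r hr
    cases n with
    | zero => simp
    | succ m => rw [Nat.add_sub_cancel, pow_succ]; field_simp
  have hmain := integral_Ioi_radial_pohozaev n hφ1 hγ2 hγc hγ0
  rw [hL, hR, integral_fun_norm_addHaar volume
      (fun r => φ r * (deriv (deriv γ) r + n / r * deriv γ r) * deriv γ r),
    integral_fun_norm_addHaar volume (fun r => deriv G r ^ 2 * (deriv F r - n / r * φ r))]
  simp only [finrank_euclideanSpace, Fintype.card_fin, Nat.add_sub_cancel, smul_eq_mul,
    nsmul_eq_mul]
  have h1 : ∫ r in Set.Ioi (0 : ℝ),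
      r ^ n * (φ r * (deriv (deriv γ) r + n / r * deriv γ r) * deriv γ r) =
      ∫ r in Set.Ioi (0 : ℝ), (r ^ n * φ r * deriv (deriv γ) r
        + n * r ^ (n - 1) * φ r * deriv γ r) * deriv γ r := by
    refine setIntegral_congr_fun measurableSet_Ioi fun r hr => ?_
    rw [← hpow r hr]
    ring
  have h2 : ∫ r in Set.Ioi (0 : ℝ), r ^ n * (deriv G r ^ 2 * (deriv F r - n / r * φ r)) =
      ∫ r in Set.Ioi (0 : ℝ),
        (r ^ n * deriv φ r - n * r ^ (n - 1) * φ r) * deriv γ r * deriv γ r := by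
    refine setIntegral_congr_fun measurableSet_Ioi fun r hr => ?_
    rw [← hpow r hr, hdG r hr, hdF r hr]
    ring
  rw [h1, h2, hmain]
  ring
end
end

section
/- Let j ≥ 1 be an integer and γ ∈ ℝ with 2γ ∉ ℤ. There exists a constant C = C(j,γ) > 0 such that for every smooth function u : [1,∞) → ℝ vanishing outside a compact set, ∫_1^∞ r^{2γ} u(r)² dr ≤ C ( Σ_{i=0}^{j} ∫_1^2 |u^{(i)}(r)|² dr + ∫_1^∞ r^{2(γ+j)} |u^{(j)}(r)|² dr ). -/
open MeasureTheory

/-- A power weight times a continuous compactly supported function is integrable on `(1, ∞)`. -/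
theorem integrableOn_rpow_mul_of_hasCompactSupport (a : ℝ) {w : ℝ → ℝ} (hw : Continuous w)
    (hc : HasCompactSupport w) : IntegrableOn (fun r => r ^ a * w r) (Set.Ioi 1) := by
  have hcont : Continuous fun r : ℝ => (max r 1) ^ a * w r :=
    ((continuous_id.max continuous_const).rpow_const fun x =>
      Or.inl (lt_of_lt_of_le one_pos (le_max_right x 1)).ne').mul hw
  have hint : Integrable fun r : ℝ => (max r 1) ^ a * w r :=
    hcont.integrable_of_hasCompactSupport hc.mul_left
  refine hint.integrableOn.congr_fun (fun r hr => ?_) measurableSet_Ioi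
  simp only [max_eq_left (le_of_lt (Set.mem_Ioi.mp hr))]

/-- Iterated derivatives of a compactly supported function are compactly supported. -/
theorem hasCompactSupport_iteratedDeriv {u : ℝ → ℝ} (hs : HasCompactSupport u) (n : ℕ) :
    HasCompactSupport (iteratedDeriv n u) := by
  induction n with
  | zero => simpa using hs
  | succ n ih => simpa only [iteratedDeriv_succ] using ih.deriv

/-- Trace inequality at the left end point of `[1, 2]`. -/
theorem sq_apply_one_le {u : ℝ → ℝ} (hu : ContDiff ℝ 1 u) :
    u 1 ^ 2 ≤ 2 * (∫ r in Set.Ioo (1 : ℝ) 2, u r ^ 2) + ∫ r in Set.Ioo (1 : ℝ) 2, deriv u r ^ 2 := by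
  have hd : Continuous (deriv u) := hu.continuous_deriv le_rfl
  have hc : Continuous u := hu.continuous
  have hderiv : ∀ x : ℝ, HasDerivAt (fun r => (2 - r) * u r ^ 2)
      (-u x ^ 2 + (2 - x) * (2 * u x * deriv u x)) x := fun x => by
    have h1 := (hu.differentiable one_ne_zero x).hasDerivAt
    refine (((hasDerivAt_id' x).const_sub 2).mul (h1.pow 2)).congr_deriv ?_
    simp only [Pi.pow_apply]
    ring
  have hI : ∀ {f : ℝ → ℝ}, Continuous f → IntervalIntegrable f volume 1 2 :=
    fun h => h.intervalIntegrable _ _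
  have hftc := intervalIntegral.integral_eq_sub_of_hasDerivAt (a := 1) (b := 2)
    (fun x _ => hderiv x) (hI (by fun_prop))
  have hmono : ∫ r in (1 : ℝ)..2, -(-u r ^ 2 + (2 - r) * (2 * u r * deriv u r)) ≤
      ∫ r in (1 : ℝ)..2, (2 * u r ^ 2 + deriv u r ^ 2) := by
    refine intervalIntegral.integral_mono_on (by norm_num) (hI (by fun_prop)) (hI (by fun_prop))
      fun r hr => ?_
    have h0 : 0 ≤ 2 - r := by linarith [hr.2]
    have h1 : 2 - r ≤ 1 := by linarith [hr.1]
    nlinarith [sq_nonneg (u r + (2 - r) * deriv u r),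
      mul_nonneg (mul_nonneg (sub_nonneg.mpr h1) (by linarith : 0 ≤ 1 + (2 - r)))
        (sq_nonneg (deriv u r))]
  rw [intervalIntegral.integral_neg, hftc,
    intervalIntegral.integral_add (hI (by fun_prop)) (hI (by fun_prop)),
    intervalIntegral.integral_const_mul] at hmono
  simp only [intervalIntegral.integral_of_le (one_le_two : (1 : ℝ) ≤ 2),
    integral_Ioc_eq_integral_Ioo] at hmono
  linarith

/-- Hardy's inequality on `(1, ∞)` with a boundary term. -/
theorem integral_rpow_mul_sq_le {a : ℝ} (ha : a + 1 ≠ 0) {u : ℝ → ℝ} (hu : ContDiff ℝ 1 u)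
    (hs : HasCompactSupport u) :
    ∫ r in Set.Ioi (1 : ℝ), r ^ a * u r ^ 2 ≤ 2 / |a + 1| * u 1 ^ 2 +
      4 / (a + 1) ^ 2 * ∫ r in Set.Ioi (1 : ℝ), r ^ (a + 2) * deriv u r ^ 2 := by
  have hd : Continuous (deriv u) := hu.continuous_deriv le_rfl
  have hc : Continuous u := hu.continuous
  have hsq : HasCompactSupport fun r => u r ^ 2 := hs.comp_left (g := (· ^ 2)) (by simp)
  have hdsq : HasCompactSupport fun r => deriv u r ^ 2 := 
    hs.deriv.comp_left (g := (· ^ 2)) (by simp)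
  have hI : IntegrableOn (fun r => r ^ a * u r ^ 2) (Set.Ioi 1) :=
    integrableOn_rpow_mul_of_hasCompactSupport a (hc.pow 2) hsq
  have hJ : IntegrableOn (fun r => r ^ (a + 1) * (u r * deriv u r)) (Set.Ioi 1) :=
    integrableOn_rpow_mul_of_hasCompactSupport (a + 1) (hc.mul hd) hs.deriv.mul_left
  have hK : IntegrableOn (fun r => r ^ (a + 2) * deriv u r ^ 2) (Set.Ioi 1) :=
    integrableOn_rpow_mul_of_hasCompactSupport (a + 2) (hd.pow 2) hdsq
  have hderiv : ∀ x ∈ Set.Ici (1 : ℝ), HasDerivAt (fun r => r ^ (a + 1) * u r ^ 2)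
      ((a + 1) * (x ^ a * u x ^ 2) + 2 * (x ^ (a + 1) * (u x * deriv u x))) x := fun x hx => by
    have h1 := (hu.differentiable one_ne_zero x).hasDerivAt
    have h0 : x ≠ 0 := (lt_of_lt_of_le one_pos hx).ne'
    refine ((Real.hasDerivAt_rpow_const (p := a + 1) (Or.inl h0)).mul (h1.pow 2)).congr_deriv ?_
    simp only [Pi.pow_apply, add_sub_cancel_right]
    ring
  have hlim : Filter.Tendsto (fun r : ℝ => r ^ (a + 1) * u r ^ 2) Filter.atTop (nhds 0) := by
    have h : HasCompactSupport fun r : ℝ => r ^ (a + 1) * u r ^ 2 := hsq.mul_left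
    rw [hasCompactSupport_iff_eventuallyEq] at h
    exact tendsto_const_nhds.congr'
      ((h.filter_mono (Filter.cocompact_le_coclosedCompact.trans' atTop_le_cocompact)).symm)
  have hftc := integral_Ioi_of_hasDerivAt_of_tendsto' hderiv
    ((hI.const_mul (a + 1)).add (hJ.const_mul 2)) hlim
  rw [integral_add (hI.const_mul _) (hJ.const_mul _), integral_const_mul,
    integral_const_mul] at hftc
  set b := a + 1 with hb
  have hb0 : 0 < |b| := abs_pos.mpr ha
  have hyoung : ∀ s : ℝ, |s| = 1 →
      ∫ r in Set.Ioi (1 : ℝ), s * (2 * (r ^ b * (u r * deriv u r))) ≤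
        ∫ r in Set.Ioi (1 : ℝ),
          (|b| / 2 * (r ^ a * u r ^ 2) + 2 / |b| * (r ^ (a + 2) * deriv u r ^ 2)) := by
    intro s hs1
    refine setIntegral_mono_on ((hJ.const_mul 2).const_mul s)
      ((hI.const_mul _).add (hK.const_mul _)) measurableSet_Ioi fun r hr => ?_
    have hr0 : 0 < r := lt_trans one_pos hr
    have e1 : r ^ b = r ^ a * r := Real.rpow_add_one hr0.ne' a
    have e2 : r ^ (a + 2) = r ^ a * r ^ 2 := by
      exact_mod_cast Real.rpow_add_natCast hr0.ne' a 2
    have hss : s ^ 2 = 1 := by rw [← sq_abs, hs1, one_pow]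
    rw [e1, e2, ← sub_nonneg]
    have : |b| / 2 * (r ^ a * u r ^ 2) + 2 / |b| * (r ^ a * r ^ 2 * deriv u r ^ 2) -
        s * (2 * (r ^ a * r * (u r * deriv u r))) =
        r ^ a / (2 * |b|) * (|b| * u r - 2 * s * r * deriv u r) ^ 2 := by
      field_simp
      linear_combination (-4 * r ^ 2 * deriv u r ^ 2) * hss
    rw [this]
    positivity
  simp only [integral_const_mul] at hyoung
  rw [integral_add (hI.const_mul _) (hK.const_mul _), integral_const_mul,
    integral_const_mul] at hyoung
  have hp := hyoung 1 (by simp)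
  have hm := hyoung (-1) (by simp)
  simp only [Real.one_rpow] at hftc
  set I := ∫ r in Set.Ioi (1 : ℝ), r ^ a * u r ^ 2
  set K := ∫ r in Set.Ioi (1 : ℝ), r ^ (a + 2) * deriv u r ^ 2
  have key : |b| / 2 * I ≤ u 1 ^ 2 + 2 / |b| * K := by
    rcases abs_cases b with ⟨h, _⟩ | ⟨h, _⟩ <;> rw [h] at hp hm ⊢ <;>
      nlinarith [sq_nonneg (u 1)]
  calc I = 2 / |b| * (|b| / 2 * I) := by field_simp
    _ ≤ 2 / |b| * (u 1 ^ 2 + 2 / |b| * K) := by gcongr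
    _ = _ := by rw [← sq_abs b]; ring

/-- weighted Hardy inequality (Lemma B.1). Let `j ≥ 1` and `γ` with
`2γ ∉ ℤ`. There is `C = C(j,γ) > 0` such that for every smooth `u : [1,∞) → ℝ`
vanishing outside a compact set,
`∫_1^∞ r^{2γ} u² dr ≤ C (‖u‖²_{H^j(1,2)} + ∫_1^∞ r^{2(γ+j)} |u^{(j)}|² dr)`. -/
theorem weighted_hardy_inequality (j : ℕ) (hj : 1 ≤ j) (γ : ℝ) (hγ : ∀ n : ℤ, 2 * γ ≠ n) :
    ∃ C > 0, ∀ u : ℝ → ℝ, ContDiff ℝ (⊤ : ℕ∞) u → HasCompactSupport u →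
      ∫ r in Set.Ioi (1:ℝ), r ^ (2 * γ) * u r ^ 2 ≤
        C * ((∑ i ∈ Finset.range (j + 1), ∫ r in Set.Ioo (1:ℝ) 2, (iteratedDeriv i u r) ^ 2)
          + ∫ r in Set.Ioi (1:ℝ), r ^ (2 * (γ + (j : ℝ))) * (iteratedDeriv j u r) ^ 2) := by
  clear hj
  induction j with
  | zero =>
    refine ⟨1, one_pos, fun u _ _ => ?_⟩
    have : 0 ≤ ∫ r in Set.Ioo (1 : ℝ) 2, u r ^ 2 := integral_nonneg fun r => sq_nonneg _
    simpa using this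
  | succ j ih =>
    obtain ⟨C, hC, ih⟩ := ih
    set b := 2 * (γ + (j : ℝ)) + 1 with hb
    have hb0 : b ≠ 0 := fun h => hγ (-(2 * j) - 1) (by push_cast; linarith)
    set D := 4 / |b| + 4 / b ^ 2
    have hb1 : 0 < |b| := abs_pos.mpr hb0
    have hD0 : 0 < D := by positivity
    refine ⟨C * (1 + D), by positivity, fun u hu hs => (ih u hu hs).trans ?_⟩
    rw [mul_assoc]
    refine mul_le_mul_of_nonneg_left ?_ hC.le
    have hsm : ContDiff ℝ 1 (iteratedDeriv j u) := by
      rw [iteratedDeriv_eq_iterate]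
      exact ContDiff.iterate_deriv' 1 j (hu.of_le (by exact_mod_cast le_top))
    have hsj : HasCompactSupport (iteratedDeriv j u) := hasCompactSupport_iteratedDeriv hs j
    have hardy := integral_rpow_mul_sq_le hb0 hsm hsj
    have trace := sq_apply_one_le hsm
    rw [← iteratedDeriv_succ] at hardy trace
    have hexp : 2 * (γ + (j : ℝ)) + 2 = 2 * (γ + ((j + 1 : ℕ) : ℝ)) := by push_cast; ring
    rw [hexp, ← hb] at hardy
    rw [Finset.sum_range_succ _ (j + 1)]
    have hn : ∀ i, 0 ≤ ∫ r in Set.Ioo (1 : ℝ) 2, iteratedDeriv i u r ^ 2 :=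
      fun i => integral_nonneg fun r => sq_nonneg _
    have hK : 0 ≤ ∫ r in Set.Ioi (1 : ℝ),
        r ^ (2 * (γ + ((j + 1 : ℕ) : ℝ))) * iteratedDeriv (j + 1) u r ^ 2 :=
      setIntegral_nonneg measurableSet_Ioi fun r hr =>
        mul_nonneg (Real.rpow_nonneg (one_pos.trans hr).le _) (sq_nonneg _)
    have hS : ∫ r in Set.Ioo (1 : ℝ) 2, iteratedDeriv j u r ^ 2 ≤
        ∑ i ∈ Finset.range (j + 1), ∫ r in Set.Ioo (1 : ℝ) 2, iteratedDeriv i u r ^ 2 :=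
      Finset.single_le_sum (f := fun i => ∫ r in Set.Ioo (1 : ℝ) 2, iteratedDeriv i u r ^ 2)
        (fun i _ => hn i) (Finset.self_mem_range_succ j)
    have hN := hn (j + 1)
    have hnj := hn j
    generalize (∑ i ∈ Finset.range (j + 1), ∫ r in Set.Ioo (1 : ℝ) 2, iteratedDeriv i u r ^ 2) = S
      at *
    generalize (∫ r in Set.Ioo (1 : ℝ) 2, iteratedDeriv j u r ^ 2) = n at *
    generalize (∫ r in Set.Ioo (1 : ℝ) 2, iteratedDeriv (j + 1) u r ^ 2) = N at *
    generalize (∫ r in Set.Ioi (1 : ℝ),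
        r ^ (2 * (γ + ((j + 1 : ℕ) : ℝ))) * iteratedDeriv (j + 1) u r ^ 2) = K at *
    have h2 : 2 / |b| * iteratedDeriv j u 1 ^ 2 ≤ 4 / |b| * (S + N) := by
      calc _ ≤ 2 / |b| * (2 * (S + N)) := by gcongr; linarith
        _ = _ := by ring
    have h4 : 4 / |b| * (S + N) ≤ D * (S + N) := by
      gcongr
      · linarith
      · exact le_add_of_nonneg_right (by positivity)
    have h5 : 4 / b ^ 2 * K ≤ D * K := by
      gcongr
      exact le_add_of_nonneg_left (by positivity)
    linarith
end

section
/- Let c > 0 and Z₀ < Z_a be real numbers. There exists a constant C > 0 (depending on c, Z₀, Z_a) such that for every C¹ function f : [Z₀, Z_a] → ℝ, ∫_{Z₀}^{Z_a} f(Z)² (Z_a − Z)^{c−1} dZ ≤ C ( f(Z₀)² + ∫_{Z₀}^{Z_a} f'(Z)² (Z_a − Z)^{c+1} dZ ). -/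
open MeasureTheory

lemma integrableOn_Icc_sub_rpow (a b : ℝ) {r : ℝ} (hr : -1 < r) (hab : a ≤ b) :
    IntegrableOn (fun x => (b - x) ^ r) (Set.Icc a b) := by
  rw [integrableOn_Icc_iff_integrableOn_Ioc, ← intervalIntegrable_iff_integrableOn_Ioc_of_le hab]
  have h := (intervalIntegral.intervalIntegrable_rpow' (a := b - a) (b := 0) hr).comp_sub_left b
  simpa using h

/-- the sharp Hardy inequality near the endpoint `Z_a` (Lemma 3.4, step 3).
For `c > 0` and `Z₀ < Z_a` there is `C > 0` such that for every `C¹` function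
`f : [Z₀, Z_a] → ℝ`,
`∫_{Z₀}^{Z_a} f² (Z_a - Z)^{c-1} dZ ≤ C (f(Z₀)² + ∫_{Z₀}^{Z_a} f'² (Z_a - Z)^{c+1} dZ)`. -/
theorem sharp_hardy_endpoint (c Z₀ Za : ℝ) (hc : 0 < c) (hZ : Z₀ < Za) :
    ∃ C > 0, ∀ f : ℝ → ℝ, ContDiffOn ℝ 1 f (Set.Icc Z₀ Za) →
      ∫ Z in Set.Ioo Z₀ Za, f Z ^ 2 * (Za - Z) ^ (c - 1) ≤
        C * (f Z₀ ^ 2 + ∫ Z in Set.Ioo Z₀ Za,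
          (derivWithin f (Set.Icc Z₀ Za) Z) ^ 2 * (Za - Z) ^ (c + 1)) := by
  have hL : 0 < (Za - Z₀) ^ c := Real.rpow_pos_of_pos (sub_pos.2 hZ) c
  refine ⟨2 / c * ((Za - Z₀) ^ c + 2 / c), by positivity, fun f hf => ?_⟩
  have hf' : ContinuousOn (derivWithin f (Set.Icc Z₀ Za)) (Set.Icc Z₀ Za) :=
    hf.continuousOn_derivWithin (uniqueDiffOn_Icc hZ) le_rfl
  have hI : IntegrableOn (fun Z => f Z ^ 2 * (Za - Z) ^ (c - 1)) (Set.Icc Z₀ Za) :=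
    (integrableOn_Icc_sub_rpow Z₀ Za (by linarith) hZ.le).continuousOn_mul
      (hf.continuousOn.pow 2) isCompact_Icc
  have hJ : IntegrableOn (fun Z => derivWithin f (Set.Icc Z₀ Za) Z ^ 2 * (Za - Z) ^ (c + 1))
      (Set.Icc Z₀ Za) :=
    (integrableOn_Icc_sub_rpow Z₀ Za (by linarith) hZ.le).continuousOn_mul
      (hf'.pow 2) isCompact_Icc
  have key := intervalIntegral.sub_le_integral_of_hasDeriv_right_of_le
    (g := fun Z => f Z ^ 2 * (Za - Z) ^ c)
    (g' := fun Z => 2 * f Z * derivWithin f (Set.Icc Z₀ Za) Z * (Za - Z) ^ c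
      - c * (f Z ^ 2 * (Za - Z) ^ (c - 1)))
    (φ := fun Z => 2 / c * (derivWithin f (Set.Icc Z₀ Za) Z ^ 2 * (Za - Z) ^ (c + 1))
      - c / 2 * (f Z ^ 2 * (Za - Z) ^ (c - 1))) hZ.le
    ((hf.continuousOn.pow 2).mul
      ((continuousOn_const.sub continuousOn_id).rpow_const fun _ _ => Or.inr hc.le))
    (fun x hx => by
      have hfx : HasDerivAt f (derivWithin f (Set.Icc Z₀ Za) x) x :=
        ((hf.differentiableOn one_ne_zero x (Set.Ioo_subset_Icc_self hx)).hasDerivWithinAt).hasDerivAt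
          (Icc_mem_nhds hx.1 hx.2)
      have hw : HasDerivAt (fun Z => (Za - Z) ^ c) (-1 * c * (Za - x) ^ (c - 1)) x :=
        ((hasDerivAt_id x).const_sub Za).rpow_const (Or.inl (sub_pos.2 hx.2).ne')
      refine HasDerivAt.hasDerivWithinAt (((hfx.pow 2).mul hw).congr_deriv ?_)
      simp only [Pi.pow_apply]
      ring)
    ((hJ.const_mul (2 / c)).sub' (hI.const_mul (c / 2)))
    (fun x hx => by
      have hw : 0 < Za - x := sub_pos.2 hx.2
      have e₁ : (Za - x) ^ c = (Za - x) ^ (c - 1) * (Za - x) := by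
        rw [← Real.rpow_add_one hw.ne', sub_add_cancel]
      have hp : 0 < (Za - x) ^ (c - 1) := Real.rpow_pos_of_pos hw _
      simp only [Real.rpow_add_one hw.ne', e₁]
      generalize derivWithin f (Set.Icc Z₀ Za) x = d
      rw [← sub_nonneg]
      have e₂ : 2 / c * (d ^ 2 * ((Za - x) ^ (c - 1) * (Za - x) * (Za - x)))
          - c / 2 * (f x ^ 2 * (Za - x) ^ (c - 1))
          - (2 * f x * d * ((Za - x) ^ (c - 1) * (Za - x)) - c * (f x ^ 2 * (Za - x) ^ (c - 1)))
          = (Za - x) ^ (c - 1) / (2 * c) * (2 * d * (Za - x) - c * f x) ^ 2 := by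
        field_simp
        ring
      rw [e₂]
      positivity)
  rw [intervalIntegral.integral_of_le hZ.le, integral_Ioc_eq_integral_Ioo,
    integral_sub ((hJ.mono_set Set.Ioo_subset_Icc_self).const_mul _)
      ((hI.mono_set Set.Ioo_subset_Icc_self).const_mul _),
    integral_const_mul, integral_const_mul, sub_self, Real.zero_rpow hc.ne'] at key
  have hJ₀ : 0 ≤ ∫ Z in Set.Ioo Z₀ Za,
      derivWithin f (Set.Icc Z₀ Za) Z ^ 2 * (Za - Z) ^ (c + 1) :=
    setIntegral_nonneg measurableSet_Ioo fun x hx =>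
      mul_nonneg (sq_nonneg _) (Real.rpow_nonneg (sub_pos.2 hx.2).le _)
  generalize (∫ Z in Set.Ioo Z₀ Za,
      derivWithin f (Set.Icc Z₀ Za) Z ^ 2 * (Za - Z) ^ (c + 1)) = J at *
  generalize (∫ Z in Set.Ioo Z₀ Za, f Z ^ 2 * (Za - Z) ^ (c - 1)) = I at *
  calc I = 2 / c * (c / 2 * I) := by field_simp
    _ ≤ 2 / c * (((Za - Z₀) ^ c + 2 / c) * (f Z₀ ^ 2 + J)) := by
      have h₁ : 0 ≤ (Za - Z₀) ^ c * J := by positivity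
      have h₂ : 0 ≤ 2 / c * f Z₀ ^ 2 := by positivity
      refine mul_le_mul_of_nonneg_left ?_ (by positivity)
      linarith
    _ = _ := by ring
end

section
/- Let d ≥ 1 be an integer, p > 1 and c real numbers, and let Q, H₁, H₂, H₃ : (0,∞) → ℝ be smooth, time-independent radial coefficients with Q > 0. Suppose ρ, Φ : [τ₀,∞)×(0,∞) → ℝ are smooth and satisfy the first-order system ∂_τρ = H₁ρ − H₂Λρ − ΔΦ + H₃Φ and ∂_τΦ = −(p−1)Qρ − H₂ΛΦ + (H₁ − c)Φ. Then Φ satisfies the second-order wave equation ∂_τ²Φ = (p−1)QΔΦ − H₂²Λ²Φ − 2H₂Λ∂_τΦ + A₁ΛΦ + A₂∂_τΦ + A₃Φ, where A₁ = H₂H₁ − H₂ΛH₂ + H₂(H₁ − c) + H₂²(ΛQ)/Q, A₂ = 2H₁ − c + H₂(ΛQ)/Q, and A₃ = −(H₁ − c)H₁ + H₂ΛH₁ − H₂(H₁ − c)(ΛQ)/Q − (p−1)Q H₃. -/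
noncomputable section

/-- Generator of dilations: `Λf = Z f'`. -/
def dilGen (f : ℝ → ℝ) (Z : ℝ) : ℝ := Z * deriv f Z

theorem hasDerivAt_comp_prodMk_left {F : ℝ × ℝ → ℝ} (hF : Differentiable ℝ F) (s z : ℝ) :
    HasDerivAt (fun s' => F (s', z)) (fderiv ℝ F (s, z) (1, 0)) s :=
  (hF (s, z)).hasFDerivAt.comp_hasDerivAt s ((hasDerivAt_id s).prodMk (hasDerivAt_const s z))

theorem hasDerivAt_comp_prodMk_right {F : ℝ × ℝ → ℝ} (hF : Differentiable ℝ F) (s z : ℝ) :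
    HasDerivAt (fun z' => F (s, z')) (fderiv ℝ F (s, z) (0, 1)) z :=
  (hF (s, z)).hasFDerivAt.comp_hasDerivAt z ((hasDerivAt_const z s).prodMk (hasDerivAt_id z))

theorem contDiff_fderiv_apply_const {F : ℝ × ℝ → ℝ} (hF : ContDiff ℝ (⊤ : ℕ∞) F) (v : ℝ × ℝ) :
    ContDiff ℝ (⊤ : ℕ∞) (fun q => fderiv ℝ F q v) :=
  (hF.fderiv_right (by simp)).clm_apply contDiff_const

theorem fderiv_fderiv_apply_comm {F : ℝ × ℝ → ℝ} (hF : ContDiff ℝ (⊤ : ℕ∞) F) (q v w : ℝ × ℝ) :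
    fderiv ℝ (fun q => fderiv ℝ F q v) q w = fderiv ℝ (fun q => fderiv ℝ F q w) q v := by
  have hd : DifferentiableAt ℝ (fderiv ℝ F) q :=
    (hF.fderiv_right (m := (⊤ : ℕ∞)) (by simp)).differentiable (by simp) q
  have hs : IsSymmSndFDerivAt ℝ F q := hF.contDiffAt.isSymmSndFDerivAt
    (by simpa using WithTop.coe_le_coe.2 (le_top : (2 : ℕ∞) ≤ ⊤))
  rw [fderiv_clm_apply hd (differentiableAt_const v),
    fderiv_clm_apply hd (differentiableAt_const w)]
  simpa using hs.eq w v

/-- Differentiable functions agreeing on `[a, ∞)` have the same derivative on all of `[a, ∞)`,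
including the endpoint. -/
theorem HasDerivAt.unique_of_eqOn_Ici {f g : ℝ → ℝ} {a x f' g' : ℝ} (hf : HasDerivAt f f' x)
    (hg : HasDerivAt g g' x) (hx : a ≤ x) (h : Set.EqOn f g (Set.Ici a)) : f' = g' :=
  (uniqueDiffOn_Ici a x hx).eq_deriv _ hf.hasDerivWithinAt
    (hg.hasDerivWithinAt.congr h (h hx))

/-- reduction of the first-order linearized system (3.2) to a
second-order quasilinear wave equation for `Φ` (Section 3.1). -/
theorem wave_equation_reduction
    (d : ℕ) (hd : 1 ≤ d) (p c : ℝ) (hp : 1 < p)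
    (Q H₁ H₂ H₃ : ℝ → ℝ)
    (hQ : ContDiffOn ℝ (⊤ : ℕ∞) Q (Set.Ioi 0)) (hH₁ : ContDiffOn ℝ (⊤ : ℕ∞) H₁ (Set.Ioi 0))
    (hH₂ : ContDiffOn ℝ (⊤ : ℕ∞) H₂ (Set.Ioi 0)) (hH₃ : ContDiffOn ℝ (⊤ : ℕ∞) H₃ (Set.Ioi 0))
    (hQpos : ∀ Z ∈ Set.Ioi (0:ℝ), 0 < Q Z)
    (τ₀ : ℝ) (ρ Φ : ℝ → ℝ → ℝ)
    (hρsmooth : ContDiff ℝ (⊤ : ℕ∞) (fun q : ℝ × ℝ => ρ q.1 q.2))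
    (hΦsmooth : ContDiff ℝ (⊤ : ℕ∞) (fun q : ℝ × ℝ => Φ q.1 q.2))
    (heq1 : ∀ τ : ℝ, τ₀ ≤ τ → ∀ Z ∈ Set.Ioi (0:ℝ),
      deriv (fun s => ρ s Z) τ =
        H₁ Z * ρ τ Z - H₂ Z * dilGen (ρ τ) Z - radialLaplacian d (Φ τ) Z + H₃ Z * Φ τ Z)
    (heq2 : ∀ τ : ℝ, τ₀ ≤ τ → ∀ Z ∈ Set.Ioi (0:ℝ),
      deriv (fun s => Φ s Z) τ =
        -(p - 1) * Q Z * ρ τ Z - H₂ Z * dilGen (Φ τ) Z + (H₁ Z - c) * Φ τ Z) :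
    ∀ τ : ℝ, τ₀ ≤ τ → ∀ Z ∈ Set.Ioi (0:ℝ),
      deriv (fun s => deriv (fun s' => Φ s' Z) s) τ =
        (p - 1) * Q Z * radialLaplacian d (Φ τ) Z
          - (H₂ Z) ^ 2 * dilGen (fun z => dilGen (Φ τ) z) Z
          - 2 * H₂ Z * dilGen (fun z => deriv (fun s => Φ s z) τ) Z
          + (H₂ Z * H₁ Z - H₂ Z * dilGen H₂ Z + H₂ Z * (H₁ Z - c)
              + (H₂ Z) ^ 2 * dilGen Q Z / Q Z) * dilGen (Φ τ) Z
          + (2 * H₁ Z - c + H₂ Z * dilGen Q Z / Q Z) * deriv (fun s => Φ s Z) τ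
          + (-(H₁ Z - c) * H₁ Z + H₂ Z * dilGen H₁ Z
              - H₂ Z * (H₁ Z - c) * (dilGen Q Z / Q Z) - (p - 1) * Q Z * H₃ Z) * Φ τ Z := by
  intro τ hτ Z hZ
  have hZ0 : (0 : ℝ) < Z := hZ
  have hQ0 : Q Z ≠ 0 := (hQpos Z hZ).ne'
  have coeff : ∀ {f : ℝ → ℝ}, ContDiffOn ℝ (⊤ : ℕ∞) f (Set.Ioi 0) → HasDerivAt f (deriv f Z) Z :=
    fun hf => ((hf.contDiffAt (Ioi_mem_nhds hZ0)).differentiableAt (by simp)).hasDerivAt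
  set P : ℝ × ℝ → ℝ := fun q => Φ q.1 q.2
  set R : ℝ × ℝ → ℝ := fun q => ρ q.1 q.2
  have hPd : Differentiable ℝ P := hΦsmooth.differentiable (by simp)
  have hRd : Differentiable ℝ R := hρsmooth.differentiable (by simp)
  have hPtd := (contDiff_fderiv_apply_const hΦsmooth (1, 0)).differentiable (by simp)
  have hPzd := (contDiff_fderiv_apply_const hΦsmooth (0, 1)).differentiable (by simp)
  have Φt : ∀ s z, HasDerivAt (fun s' => Φ s' z) (fderiv ℝ P (s, z) (1, 0)) s :=
    hasDerivAt_comp_prodMk_left hPd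
  have Φz : ∀ s z, HasDerivAt (Φ s) (fderiv ℝ P (s, z) (0, 1)) z :=
    hasDerivAt_comp_prodMk_right hPd
  have ρt : ∀ s z, HasDerivAt (fun s' => ρ s' z) (fderiv ℝ R (s, z) (1, 0)) s :=
    hasDerivAt_comp_prodMk_left hRd
  have ρz : ∀ s z, HasDerivAt (ρ s) (fderiv ℝ R (s, z) (0, 1)) z :=
    hasDerivAt_comp_prodMk_right hRd
  have Φtt := hasDerivAt_comp_prodMk_left hPtd τ Z
  have Φtz := hasDerivAt_comp_prodMk_right hPtd τ Z
  have Φzt := hasDerivAt_comp_prodMk_left hPzd τ Z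
  have Φzz := hasDerivAt_comp_prodMk_right hPzd τ Z
  rw [fderiv_fderiv_apply_comm hΦsmooth] at Φzt
  have e1 := heq1 τ hτ Z hZ
  simp only [dilGen, radialLaplacian, (ρt _ _).deriv, (ρz _ _).deriv,
    funext fun z => (Φz τ z).deriv, Φzz.deriv] at e1
  simp only [dilGen, (Φt _ _).deriv, (Φz _ _).deriv] at heq2
  have e2 := heq2 τ hτ Z hZ
  have time := Φtt.unique_of_eqOn_Ici
    ((((ρt τ Z).const_mul (-(p - 1) * Q Z)).sub ((Φzt.const_mul Z).const_mul (H₂ Z))).add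
      ((Φt τ Z).const_mul (H₁ Z - c))) hτ fun s hs => heq2 s hs Z hZ
  have space := Φtz.unique
    ((((((coeff hQ).const_mul (-(p - 1))).mul (ρz τ Z)).sub
      ((coeff hH₂).mul ((hasDerivAt_id Z).mul Φzz))).add
      (((coeff hH₁).sub_const c).mul (Φz τ Z))).congr_of_eventuallyEq
      (Filter.eventually_of_mem (Ioi_mem_nhds hZ0) fun z hz => heq2 τ hτ z hz))
  have dil := ((hasDerivAt_id Z).mul Φzz).deriv
  simp only [id, Pi.mul_def] at dil space
  simp only [dilGen, radialLaplacian, (Φt _ _).deriv, funext fun z => (Φz τ z).deriv, Φzz.deriv,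
    Φtz.deriv, Φtt.deriv, dil]
  rw [time, e1]
  obtain ⟨W, hW⟩ : ∃ W, deriv Q Z = W * Q Z := ⟨deriv Q Z / Q Z, by field_simp⟩
  rw [hW] at space ⊢
  rw [mul_div_assoc (H₂ Z), mul_div_assoc (H₂ Z ^ 2),
    show Z * (W * Q Z) / Q Z = Z * W by field_simp]
  linear_combination (-(H₁ Z) - H₂ Z * Z * W) * e2 + H₂ Z * Z * space
end
end

section
/- Let d ≥ 5 be a real number and ℓ ∈ (0, d − 2√d). Set r = (ℓ+d)/(ℓ+√d), e = (r−2)/r, and s_c = d/2 − ℓ/2. Then the exponent σ = (1/(1+e))[ s_c − e(d/2 + ℓ/2) ] satisfies 1 < σ < s_c. -/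
/-- For `d ≥ 5` and `ℓ ∈ (0, d - 2√d)`, with `r = (ℓ+d)/(ℓ+√d)`,
`e = (r-2)/r` and `s_c = d/2 - ℓ/2`, the exponent
`σ = (1/(1+e))(s_c - e(d/2 + ℓ/2))` satisfies `1 < σ < s_c`. -/
theorem sobolev_exponent_below_scaling (d ℓ : ℝ) (hd : 5 ≤ d) (hℓ1 : 0 < ℓ)
    (hℓ2 : ℓ < d - 2 * Real.sqrt d)
    (r e sc σ : ℝ)
    (hr : r = (ℓ + d) / (ℓ + Real.sqrt d)) (he : e = (r - 2) / r)
    (hsc : sc = d / 2 - ℓ / 2)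
    (hσ : σ = (1 / (1 + e)) * (sc - e * (d / 2 + ℓ / 2))) :
    1 < σ ∧ σ < sc := by
  obtain ⟨s, hs⟩ : ∃ s, s = Real.sqrt d := ⟨_, rfl⟩
  have hds : d = s ^ 2 := by rw [hs, Real.sq_sqrt (by linarith)]
  have hs1 : 1 < s := by rw [hs, Real.lt_sqrt zero_le_one]; linarith
  rw [← hs] at hr hℓ2
  have hsum : 0 < ℓ + d := by linarith
  have he' : e = (d - ℓ - 2 * s) / (ℓ + d) := by
    have : ℓ + s ≠ 0 := by linarith
    rw [he, hr]
    field_simp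
    ring
  have h1e : 1 + e = 2 * s * (s - 1) / (ℓ + d) := by
    rw [he', hds]
    rw [hds] at hsum
    field_simp
    ring
  have hσ' : σ = (ℓ + d) / (2 * (s - 1)) := by
    have hs1' : s - 1 ≠ 0 := by linarith
    have hs0 : s ≠ 0 := by linarith
    rw [hσ, h1e, he', hsc]
    field_simp
    ring
  have hden : 0 < 2 * (s - 1) := by linarith
  rw [hσ', hsc, lt_div_iff₀ hden, div_lt_iff₀ hden]
  constructor
  · nlinarith [sq_nonneg (s - 1)]
  · rw [hds] at hℓ2 ⊢
    nlinarith [mul_lt_mul_of_pos_left hℓ2 (by linarith : 0 < s)]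
end
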